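/- There is no vote assignment equivalent to the 6-node wheel protocol: there exists no function v : Fin 6 → ℕ with v(i) > 0 for all i such that, writing V = Σᵢ v(i), for every finite set S ⊆ Fin 6 one has 2·(Σ_{i∈S} v(i)) > V if and only if S contains one of the five sets {0,1,3,5}, {0,1,2,4}, {0,2,3,5}, {0,1,3,4}, {0,2,4,5} as a subset. -/

import Mathlib

/-- The five eligible write quorums of the 6-node wheel. -/
def wheelQuorums6 : Finset (Finset (Fin 6)) :=
  {{0, 1, 3, 5}, {0, 1, 2, 4}, {0, 2, 3, 5}, {0, 1, 3, 4}, {0, 2, 4, 5}}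

/-- There is no vote assignment equivalent to the 6-node wheel protocol:
no positive vote assignment `v : Fin 6 → ℕ` makes the sets exceeding half the total
vote exactly the supersets of the five eligible write quorums. -/
theorem no_equivalent_vote_assignment :
    ¬ ∃ v : Fin 6 → ℕ, (∀ i, 0 < v i) ∧
      ∀ S : Finset (Fin 6),
        (2 * ∑ i ∈ S, v i > ∑ i, v i) ↔ ∃ Q ∈ wheelQuorums6, Q ⊆ S := by
  rintro ⟨v, hpos, hv⟩
  have hrim : ¬ 2 * ∑ i ∈ ({1, 2, 3, 4, 5} : Finset (Fin 6)), v i > ∑ i, v i :=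
    fun h => absurd ((hv _).1 h) (by decide)
  have hhub : ¬ 2 * ∑ i ∈ ({0, 1} : Finset (Fin 6)), v i > ∑ i, v i :=
    fun h => absurd ((hv _).1 h) (by decide)
  have hcover : ∑ i, v i = v 0 + ∑ i ∈ ({1, 2, 3, 4, 5} : Finset (Fin 6)), v i := by
    rw [← Finset.sum_insert (by decide)]
    rfl
  have hpair : ∑ i ∈ ({0, 1} : Finset (Fin 6)), v i = v 0 + v 1 :=
    Finset.sum_pair (by decide)
  have h1 := hpos 1
  omega
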